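/- For every i ∈ F_p, the complex number G · E_ν(i,i) is real, where G := p^{−1/2} · Σ_{y ∈ F_p} ψ(y²) is the normalized Gauss sum. -/

import Mathlib

open Finset

open Classical in
/-- The quadratic character of `F_p`, with values in `ℂ`. -/
noncomputable def quadChar (p : ℕ) (t : ZMod p) : ℂ :=
  if t = 0 then 0 else if IsSquare t then 1 else -1

/-- The normalized Gauss sum `G = p^{-1/2} ∑_y ψ(y²)`. -/
noncomputable def gaussSum' (p : ℕ) [NeZero p] (ψ : AddChar (ZMod p) ℂ) : ℂ :=
  (Real.sqrt p : ℂ)⁻¹ * ∑ y : ZMod p, ψ (y ^ 2)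


/-- The exponential sum `E_ν(i,x)` attached to a character `ν` of the norm-one
group of the quadratic extension `K/F_p`, formed with the additive character
`χ`. -/
noncomputable def Esum (p : ℕ) [Fact p.Prime] (χ : AddChar (ZMod p) ℂ)
    (D : ZMod p) {K : Type} [Field K] [Algebra (ZMod p) K] (u : K)
    (ν : K → ℂ) (i x : ZMod p) : ℂ :=
  ∑ t ∈ (Finset.univ : Finset (ZMod p)).erase 0,
    (starRingEnd ℂ) (ν ((1 + algebraMap (ZMod p) K t * u) /
        (1 - algebraMap (ZMod p) K t * u))) *
      quadChar p (-2 * t / (1 - D * t ^ 2)) *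
      χ ((x - i) ^ 2 / (2 * t) + D * t * (x + i) ^ 2 / 2)

lemma quadChar_eq_quadraticChar (p : ℕ) [Fact p.Prime] (t : ZMod p) :
    quadChar p t = (quadraticChar (ZMod p) t : ℂ) := by
  rw [quadraticChar_apply, quadraticCharFun, quadChar]
  split_ifs <;> simp

lemma quadraticChar_neg_one_mul_self (p : ℕ) [Fact p.Prime] :
    (quadraticChar (ZMod p) (-1) : ℂ) * (quadraticChar (ZMod p) (-1) : ℂ) = 1 := by
  rw [← Int.cast_mul, ← map_mul]
  simp

lemma sum_addChar_sq {p : ℕ} [Fact p.Prime] (hp2 : p ≠ 2) {ψ : AddChar (ZMod p) ℂ}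
    (hψ : ψ ≠ 1) :
    ∑ y : ZMod p, ψ (y ^ 2) = ∑ b : ZMod p, (quadraticChar (ZMod p) b : ℂ) * ψ b := by
  have hcard (b : ZMod p) :
      ((univ.filter fun y : ZMod p => y ^ 2 = b).card : ℂ) =
        (quadraticChar (ZMod p) b : ℂ) + 1 := by
    have h := quadraticChar_card_sqrts (F := ZMod p) (by rwa [ZMod.ringChar_zmod_n]) b
    rw [Set.toFinset_ofPred] at h
    exact_mod_cast h
  calc ∑ y : ZMod p, ψ (y ^ 2)
      = ∑ b : ZMod p, ∑ y ∈ univ.filter (fun y : ZMod p => y ^ 2 = b), ψ (y ^ 2) :=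
        (sum_fiberwise _ _ _).symm
    _ = ∑ b : ZMod p, ((quadraticChar (ZMod p) b : ℂ) + 1) * ψ b := by
        refine sum_congr rfl fun b _ => ?_
        rw [← hcard, ← nsmul_eq_mul, ← sum_const]
        refine sum_congr rfl fun y hy => ?_
        rw [(mem_filter.mp hy).2]
    _ = _ := by
        simp only [add_mul, one_mul, sum_add_distrib]
        rw [AddChar.sum_eq_zero_of_ne_one hψ, add_zero]

lemma conj_gaussSum' {p : ℕ} [Fact p.Prime] (hp2 : p ≠ 2) {ψ : AddChar (ZMod p) ℂ}
    (hψ : ψ ≠ 1) :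
    (starRingEnd ℂ) (gaussSum' p ψ) =
      (quadraticChar (ZMod p) (-1) : ℂ) * gaussSum' p ψ := by
  rw [gaussSum', sum_addChar_sq hp2 hψ, map_mul, map_inv₀, Complex.conj_ofReal,
    mul_left_comm]
  congr 1
  rw [map_sum, mul_sum]
  refine Fintype.sum_equiv (Equiv.neg (ZMod p)) _ _ fun b => ?_
  rw [Equiv.neg_apply, map_mul, ← AddChar.map_neg_eq_conj, map_intCast, ← mul_assoc,
    ← Int.cast_mul, ← map_mul, neg_one_mul, neg_neg]

lemma one_sub_algebraMap_mul_ne_zero {F K : Type*} [Field F] [Field K] [Algebra F K] {D : F}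
    (hD : ¬ IsSquare D) {u : K} (hu : u ^ 2 = algebraMap F K D) (t : F) :
    1 - algebraMap F K t * u ≠ 0 := by
  intro h
  have h1 : algebraMap F K (t ^ 2 * D) = algebraMap F K 1 := by
    rw [map_mul, map_pow, ← hu, ← mul_pow, ← sub_eq_zero.mp h]
    simp
  have h2 : t ^ 2 * D = 1 := (algebraMap F K).injective h1
  have ht : t ≠ 0 := by
    rintro rfl
    simp at h2
  exact hD ⟨t⁻¹, by field_simp; linear_combination h2⟩

lemma pow_prime_eq_neg_of_sq_eq {p : ℕ} [Fact p.Prime] (hp2 : p ≠ 2) {D : ZMod p}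
    (hD : ¬ IsSquare D) {K : Type*} [Field K] [Algebra (ZMod p) K] {u : K}
    (hu : u ^ 2 = algebraMap (ZMod p) K D) : u ^ p = -u := by
  have hD0 : D ≠ 0 := by
    rintro rfl
    exact hD (IsSquare.zero)
  have hodd : p % 2 = 1 := (Fact.out : p.Prime).eq_two_or_odd.resolve_left hp2
  have hhalf : D ^ (p / 2) = -1 :=
    (ZMod.pow_div_two_eq_neg_one_or_one p hD0).resolve_left
      fun h => hD ((ZMod.euler_criterion p hD0).mpr h)
  calc u ^ p = u ^ (2 * (p / 2) + 1) := by congr 1; omega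
    _ = -u := by rw [pow_succ, pow_mul, hu, ← map_pow, hhalf]; simp

lemma cayley_pow_succ_eq_one {p : ℕ} [Fact p.Prime] (hp2 : p ≠ 2) {D : ZMod p}
    (hD : ¬ IsSquare D) {K : Type*} [Field K] [Algebra (ZMod p) K] {u : K}
    (hu : u ^ 2 = algebraMap (ZMod p) K D) (t : ZMod p) :
    ((1 + algebraMap (ZMod p) K t * u) / (1 - algebraMap (ZMod p) K t * u)) ^ (p + 1) = 1 := by
  have : CharP K p := charP_of_injective_algebraMap (algebraMap (ZMod p) K).injective p
  have h1 := one_sub_algebraMap_mul_ne_zero hD hu t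
  have h2 : 1 + algebraMap (ZMod p) K t * u ≠ 0 := by
    simpa using one_sub_algebraMap_mul_ne_zero hD hu (-t)
  have hpow : (algebraMap (ZMod p) K t * u) ^ p = -(algebraMap (ZMod p) K t * u) := by
    rw [mul_pow, ← map_pow, ZMod.pow_card, pow_prime_eq_neg_of_sq_eq hp2 hD hu, mul_neg]
  rw [pow_succ, div_pow, add_pow_char, sub_pow_char, one_pow, hpow, sub_neg_eq_add,
    ← sub_eq_add_neg]
  field_simp

lemma conj_eq_map_inv_of_multiplicative {K : Type*} [Field K] {n : ℕ} (hn : n ≠ 0) {ν : K → ℂ}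
    (hν0 : ∀ z : K, z ^ n = 1 → ν z ≠ 0)
    (hνm : ∀ z w : K, z ^ n = 1 → w ^ n = 1 → ν (z * w) = ν z * ν w)
    {z : K} (hz : z ^ n = 1) : (starRingEnd ℂ) (ν z) = ν z⁻¹ := by
  have hone : ν 1 = 1 := by
    have h := hνm 1 1 (one_pow _) (one_pow _)
    rw [mul_one] at h
    exact (mul_eq_left₀ (hν0 1 (one_pow _))).mp h.symm
  have hpow (k : ℕ) : ν (z ^ k) = ν z ^ k := by
    induction k with
    | zero => simpa using hone
    | succ k ih =>
      rw [pow_succ, hνm _ _ (by rw [← pow_mul, mul_comm, pow_mul, hz, one_pow]) hz, ih, pow_succ]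
  have hnorm : ‖ν z‖ = 1 := by
    refine Complex.norm_eq_one_of_pow_eq_one (n := n) ?_ hn
    rw [← hpow, hz, hone]
  have hz0 : z ≠ 0 := by
    rintro rfl
    simp [hn] at hz
  have hinv : ν z * ν z⁻¹ = 1 := by
    rw [← hνm z z⁻¹ hz (by rw [inv_pow, hz, inv_one]), mul_inv_cancel₀ hz0, hone]
  rw [← Complex.inv_eq_conj hnorm]
  exact inv_eq_of_mul_eq_one_right hinv

lemma conj_Esum_diag {p : ℕ} [Fact p.Prime] (hp2 : p ≠ 2) (χ : AddChar (ZMod p) ℂ)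
    {D : ZMod p} (hD : ¬ IsSquare D) {K : Type} [Field K] [Algebra (ZMod p) K] {u : K}
    (hu : u ^ 2 = algebraMap (ZMod p) K D) {ν : K → ℂ}
    (hν0 : ∀ z : K, z ^ (p + 1) = 1 → ν z ≠ 0)
    (hνm : ∀ z w : K, z ^ (p + 1) = 1 → w ^ (p + 1) = 1 → ν (z * w) = ν z * ν w)
    (i : ZMod p) :
    (starRingEnd ℂ) (Esum p χ D u ν i i) =
      (quadraticChar (ZMod p) (-1) : ℂ) * Esum p χ D u ν i i := by
  rw [Esum, map_sum, mul_sum]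
  refine sum_equiv (Equiv.neg (ZMod p)) (by simp) fun t _ => ?_
  have hcayley : (1 + algebraMap (ZMod p) K (-t) * u) / (1 - algebraMap (ZMod p) K (-t) * u) =
      ((1 + algebraMap (ZMod p) K t * u) / (1 - algebraMap (ZMod p) K t * u))⁻¹ := by
    rw [inv_div, map_neg, neg_mul, sub_neg_eq_add, ← sub_eq_add_neg]
  have hquad : -2 * -t / (1 - D * (-t) ^ 2) = -1 * (-2 * t / (1 - D * t ^ 2)) := by
    rw [neg_sq]
    ring
  have harg : (i - i) ^ 2 / (2 * -t) + D * -t * (i + i) ^ 2 / 2 =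
      -((i - i) ^ 2 / (2 * t) + D * t * (i + i) ^ 2 / 2) := by
    rw [sub_self]
    ring
  rw [Equiv.neg_apply, hcayley, hquad, harg, quadChar_eq_quadraticChar,
    quadChar_eq_quadraticChar, map_mul (quadraticChar _), Int.cast_mul, AddChar.map_neg_eq_conj,
    ← conj_eq_map_inv_of_multiplicative p.succ_ne_zero hν0 hνm
      (cayley_pow_succ_eq_one hp2 hD hu t), map_mul, map_mul, map_intCast]
  linear_combination -(starRingEnd ℂ) ((starRingEnd ℂ)
    (ν ((1 + algebraMap (ZMod p) K t * u) / (1 - algebraMap (ZMod p) K t * u)))) *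
    (quadraticChar (ZMod p) (-2 * t / (1 - D * t ^ 2)) : ℂ) * (starRingEnd ℂ)
    (χ ((i - i) ^ 2 / (2 * t) + D * t * (i + i) ^ 2 / 2)) * quadraticChar_neg_one_mul_self p

/-- The number `G · E_ν(i,i)` is real. -/
theorem gauss_mul_esum_diag_real
    (p : ℕ) [Fact p.Prime] (hp2 : p ≠ 2)
    (ψ : AddChar (ZMod p) ℂ) (hψ : ψ ≠ 1)
    (D : ZMod p) (hD : ¬ IsSquare D)
    (K : Type) [Field K] [Algebra (ZMod p) K] [Fintype K]
    (hK : Fintype.card K = p ^ 2)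
    (u : K) (hu : u ^ 2 = algebraMap (ZMod p) K D)
    (ν : K → ℂ)
    (hν0 : ∀ z : K, z ^ (p + 1) = 1 → ν z ≠ 0)
    (hνm : ∀ z w : K, z ^ (p + 1) = 1 → w ^ (p + 1) = 1 →
      ν (z * w) = ν z * ν w)
    (i : ZMod p) :
    (gaussSum' p ψ * Esum p ψ D u ν i i).im = 0 := by
  rw [← Complex.conj_eq_iff_im, map_mul, conj_gaussSum' hp2 hψ,
    conj_Esum_diag hp2 ψ hD hu hν0 hνm]
  linear_combination gaussSum' p ψ * Esum p ψ D u ν i i * quadraticChar_neg_one_mul_self p
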